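/- arXiv:math/0609242 — 2 statements merged into one kernel-verified Lean document; each statement's English description precedes it below -/
import Mathlib

section
/- Let n ≥ 1 and let P_n = ⟨a_0, …, a_k⟩ be the n-th P-sequence. Then for every integer s ≥ n, the polynomial F_{n,s}(x) = ∑_{i=0}^k a_i (i+x)^s has degree exactly s - n. -/
/-- One step of the recursive construction of P-sequences. -/
def Pnext (a : List ℤ) : List ℤ :=
  if a.getLast! = -a.head! then a ++ a.reverse
  else a.dropLast ++ [0] ++ (a.dropLast.reverse.map (fun x => -x))

/-- `Pseq (n-1)` is the `n`-th P-sequence `P_n` (so `Pseq 0 = P_1 = ⟨1,-1⟩`). -/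
def Pseq : ℕ → List ℤ
  | 0 => [1, -1]
  | n + 1 => Pnext (Pseq n)

open Polynomial in
/-- The polynomial `∑ i, a_i (X + i) ^ s` attached to a list `a`. -/
noncomputable def shiftedPowerSum (s : ℕ) (a : List ℤ) : ℝ[X] :=
  ∑ i ∈ Finset.range a.length, C ((a.getD i 0 : ℤ) : ℝ) * (X + C (i : ℝ)) ^ s

namespace shiftedPowerSum

open Polynomial

theorem nil (s : ℕ) : shiftedPowerSum s [] = 0 := by
  simp [shiftedPowerSum]

theorem cons (s : ℕ) (x : ℤ) (l : List ℤ) :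
    shiftedPowerSum s (x :: l) = C (x : ℝ) * X ^ s + taylor 1 (shiftedPowerSum s l) := by
  simp only [shiftedPowerSum, List.length_cons, Finset.sum_range_succ', map_sum, taylor_mul,
    taylor_pow, taylor_C, map_add, taylor_X, List.getD_cons_succ, List.getD_cons_zero]
  rw [add_comm]
  congr 1
  · simp
  · refine Finset.sum_congr rfl fun i _ => ?_
    push_cast
    rw [C_add]
    ring

theorem append (s : ℕ) (l l' : List ℤ) :
    shiftedPowerSum s (l ++ l') =
      shiftedPowerSum s l + taylor (l.length : ℝ) (shiftedPowerSum s l') := by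
  induction l with
  | nil => simp [nil]
  | cons x l ih =>
    rw [List.cons_append, cons, cons, ih, map_add, taylor_taylor, List.length_cons]
    push_cast
    rw [add_assoc]
    simp only [add_comm]

theorem map_neg (s : ℕ) (l : List ℤ) :
    shiftedPowerSum s (l.map fun x => -x) = -shiftedPowerSum s l := by
  induction l with
  | nil => simp [nil]
  | cons x l ih =>
    rw [List.map_cons, cons, cons, ih]
    simp only [Int.cast_neg, _root_.map_neg]
    ring

end shiftedPowerSum

/-- Subtracting a nontrivial translate lowers the degree of a real polynomial by exactly one. -/
theorem Polynomial.degree_sub_taylor {p : Polynomial ℝ} {d : ℕ} (hp : p.degree = (d + 1 : ℕ))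
    {c : ℝ} (hc : c ≠ 0) : (p - taylor c p).degree = d := by
  have hp0 : p ≠ 0 := ne_zero_of_degree_gt (n := ⊥) (hp ▸ WithBot.bot_lt_coe _)
  have hn : p.natDegree = d + 1 := natDegree_eq_of_degree_eq_some hp
  have hlt : (p - taylor c p).degree < (d + 1 : ℕ) := by
    rw [← hp]
    exact degree_sub_lt_left (degree_taylor p c).symm hp0 (by simp)
  have hle : (p - taylor c p).natDegree ≤ d :=
    natDegree_le_iff_coeff_eq_zero.mpr fun N hN =>
      (degree_lt_iff_coeff_zero _ _).mp hlt N hN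
  refine le_antisymm (degree_le_of_natDegree_le hle) (le_degree_of_ne_zero ?_)
  have hcoeff : (taylor c p).coeff d = p.coeff d + (d + 1) * p.coeff (d + 1) * c := by
    have hdeg : (hasseDeriv d p).natDegree < 2 := by
      have := natDegree_hasseDeriv_le p d
      omega
    rw [taylor_coeff, eval_eq_sum_range' hdeg]
    simp [Finset.sum_range_succ, hasseDeriv_coeff, add_comm 1 d]
  have hlead : p.coeff (d + 1) ≠ 0 := by
    rw [← hn]
    exact leadingCoeff_ne_zero.mpr hp0
  rw [coeff_sub, hcoeff, sub_add_cancel_left]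
  exact neg_ne_zero.mpr (mul_ne_zero (mul_ne_zero (by positivity) hlead) hc)

/-- The invariant of the construction: a list of length at least two that starts with `1` and is
palindromic or antipalindromic. -/
def IsSignedPalindrome (a : List ℤ) : Prop :=
  ∃ t : List ℤ, t ≠ [] ∧ a = 1 :: t ∧ (a.reverse = a ∨ a.reverse = a.map fun x => -x)

theorem List.getLast!_eq_head!_reverse (a : List ℤ) : a.getLast! = a.reverse.head! := by
  cases a using List.reverseRecOn <;> simp [List.getLast!_eq_getLast?_getD]

theorem Pnext_of_antipalindrome {t : List ℤ}
    (h : (1 :: t).reverse = (1 :: t).map fun x => -x) :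
    Pnext (1 :: t) = (1 :: t) ++ (1 :: t).map fun x => -x := by
  rw [Pnext, if_pos, h]
  rw [List.getLast!_eq_head!_reverse, h]
  simp

theorem Pnext_of_palindrome {d : List ℤ} {t : List ℤ} (h : (1 :: t).reverse = 1 :: t)
    (hd : 1 :: t = d ++ [1]) : Pnext (1 :: t) = d ++ [0] ++ d.reverse.map fun x => -x := by
  rw [Pnext, if_neg, hd, List.dropLast_concat]
  rw [List.getLast!_eq_head!_reverse, h]
  simp

theorem exists_eq_append_one {t : List ℤ} (ht : t ≠ []) (h : (1 :: t).reverse = 1 :: t) :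
    ∃ u : List ℤ, 1 :: t = (1 :: u) ++ [1] := by
  obtain ⟨u, x, rfl⟩ : ∃ u x, t = u ++ [x] := ⟨_, _, (List.dropLast_append_getLast ht).symm⟩
  simp only [List.reverse_cons, List.reverse_append, List.reverse_nil, List.nil_append,
    List.cons_append, List.cons.injEq] at h
  exact ⟨u, by simp [h.1]⟩

theorem IsSignedPalindrome.next {a : List ℤ} (ha : IsSignedPalindrome a) :
    IsSignedPalindrome (Pnext a) := by
  obtain ⟨t, ht, rfl, h | h⟩ := ha
  · obtain ⟨u, hu⟩ := exists_eq_append_one ht h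
    rw [Pnext_of_palindrome h hu]
    exact ⟨u ++ [0] ++ (1 :: u).reverse.map fun x => -x, by simp, by simp, Or.inr (by
      simp [← List.map_reverse])⟩
  · rw [Pnext_of_antipalindrome h, ← h]
    exact ⟨t ++ (1 :: t).reverse, by simp, by simp, Or.inl (by simp)⟩

open Polynomial in
theorem IsSignedPalindrome.exists_shiftedPowerSum_next {a : List ℤ} (ha : IsSignedPalindrome a) :
    ∃ c : ℝ, c ≠ 0 ∧ ∀ s, shiftedPowerSum s (Pnext a) =
      shiftedPowerSum s a - taylor c (shiftedPowerSum s a) := by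
  obtain ⟨t, ht, rfl, h | h⟩ := ha
  · obtain ⟨u, hu⟩ := exists_eq_append_one ht h
    refine ⟨((1 :: u).length : ℝ), by simp; positivity, fun s => ?_⟩
    rw [Pnext_of_palindrome h hu]
    generalize 1 :: u = d at hu
    have h' : 1 :: t = 1 :: d.reverse := by rw [← h, hu]; simp
    have hcons : taylor (d.length : ℝ) (shiftedPowerSum s (1 :: t)) =
        taylor (d.length : ℝ) (X ^ s) +
          taylor ((d.length : ℝ) + 1) (shiftedPowerSum s d.reverse) := by
      rw [h', shiftedPowerSum.cons, map_add, taylor_taylor]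
      simp [add_comm]
    rw [hcons, hu]
    simp only [shiftedPowerSum.append, shiftedPowerSum.map_neg, shiftedPowerSum.cons,
      shiftedPowerSum.nil, List.length_append, List.length_singleton]
    simp only [Int.cast_one, C_1, one_mul, Int.cast_zero, zero_mul, map_zero, add_zero,
      _root_.map_neg, Nat.cast_add, Nat.cast_one]
    ring
  · refine ⟨((1 :: t).length : ℝ), by simp; positivity, fun s => ?_⟩
    rw [Pnext_of_antipalindrome h, shiftedPowerSum.append, shiftedPowerSum.map_neg, map_neg,
      sub_eq_add_neg]

theorem isSignedPalindrome_Pseq (n : ℕ) : IsSignedPalindrome (Pseq n) := by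
  induction n with
  | zero => exact ⟨[-1], by simp, rfl, Or.inr (by simp [Pseq])⟩
  | succ n ih => exact ih.next

theorem degree_shiftedPowerSum_Pseq (n m : ℕ) :
    (shiftedPowerSum (m + (n + 1)) (Pseq n)).degree = m := by
  induction n generalizing m with
  | zero =>
    have h : shiftedPowerSum (m + (0 + 1)) (Pseq 0) =
        Polynomial.X ^ (m + 1) - Polynomial.taylor 1 (Polynomial.X ^ (m + 1)) := by
      simp [Pseq, shiftedPowerSum.cons, shiftedPowerSum.nil, sub_eq_add_neg]
    rw [h]
    exact Polynomial.degree_sub_taylor (Polynomial.degree_X_pow _) one_ne_zero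
  | succ n ih =>
    obtain ⟨c, hc, h⟩ := (isSignedPalindrome_Pseq n).exists_shiftedPowerSum_next
    rw [Pseq, h]
    refine Polynomial.degree_sub_taylor ?_ hc
    rw [← ih (m + 1)]
    congr 2
    omega

/-- for `n ≥ 1`, `P_n = ⟨a_0,…,a_k⟩` and `s ≥ n`, the polynomial
`F_{n,s}(X) = ∑_{i=0}^k a_i (X+i)^s` has degree exactly `s - n`. -/
theorem Fns_degree (n : ℕ) (hn : 1 ≤ n) (s : ℕ) (hs : n ≤ s) :
    (∑ i ∈ Finset.range (Pseq (n - 1)).length,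
        Polynomial.C (((Pseq (n - 1)).getD i 0 : ℝ)) *
          (Polynomial.X + Polynomial.C (i : ℝ)) ^ s).degree = ((s - n : ℕ) : WithBot ℕ) := by
  have h := degree_shiftedPowerSum_Pseq (n - 1) (s - n)
  rwa [Nat.sub_add_cancel hn, Nat.sub_add_cancel hs] at h
end

section
/- Let m ≥ 1 be an integer, let δ be a real number with m-1 < δ < m, and let P_m = ⟨a_0, …, a_k⟩ be the m-th P-sequence. Define E(n) = ∑_{i=0}^k a_i (n-i)^δ for integers n > k. Then E(n) = (-1)^m · C(δ,m) · (∑_{i=0}^k a_i i^m) · n^{δ-m} + o(n^{δ-m}) as n → ∞, where C(δ,m) is the generalized binomial coefficient; in particular, since C(δ,m) > 0 and sgn(∑_{i=0}^k a_i i^m) = (-1)^m, the sequence E(n) is ultimately positive and tends to 0. -/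
open Filter Asymptotics

/-- The generalized binomial coefficient `C(δ,m) = δ(δ-1)⋯(δ-m+1)/m!`. -/
noncomputable def genBinom (δ : ℝ) (m : ℕ) : ℝ :=
  (∏ j ∈ Finset.range m, (δ - j)) / (m.factorial : ℝ)

/-- The sum `∑ a_i f(i)` of `f` weighted by the entries of the list `a`. -/
noncomputable def weightedSum (a : List ℤ) (f : ℕ → ℝ) : ℝ :=
  ∑ i ∈ Finset.range a.length, (a.getD i 0 : ℝ) * f i

lemma weightedSum_nil (f : ℕ → ℝ) : weightedSum [] f = 0 := by
  simp [weightedSum]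

lemma weightedSum_cons (x : ℤ) (a : List ℤ) (f : ℕ → ℝ) :
    weightedSum (x :: a) f = x * f 0 + weightedSum a (fun i => f (i + 1)) := by
  simp [weightedSum, Finset.sum_range_succ', add_comm]

lemma weightedSum_append (a b : List ℤ) (f : ℕ → ℝ) :
    weightedSum (a ++ b) f = weightedSum a f + weightedSum b (fun i => f (i + a.length)) := by
  induction a generalizing f with
  | nil => simp [weightedSum_nil]
  | cons x a ih =>
    simp [weightedSum_cons, ih, add_assoc]

lemma weightedSum_map_neg (a : List ℤ) (f : ℕ → ℝ) :
    weightedSum (a.map (fun x => -x)) f = -weightedSum a f := by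
  induction a generalizing f with
  | nil => simp [weightedSum_nil]
  | cons x a ih => simp [weightedSum_cons, ih]; ring

lemma Pnext_of_reverse_eq_map_neg {t : List ℤ}
    (h : (1 :: t).reverse = (1 :: t).map (fun x => -x)) :
    Pnext (1 :: t) = (1 :: t) ++ (1 :: t).map (fun x => -x) := by
  have hl : (1 :: t).getLast! = -1 := by
    have h' := congrArg List.head? h
    simpa [List.getLast!_eq_getLast?_getD, List.getLast?_cons] using congrArg (Option.getD · 0) h'
  rw [Pnext, if_pos (by simpa using hl), h]

lemma eq_append_one_of_reverse_eq {t : List ℤ} (ht : t ≠ [])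
    (h : (1 :: t).reverse = 1 :: t) : 1 :: t = (1 :: t.dropLast) ++ [1] := by
  obtain ⟨s, x, rfl⟩ := List.eq_nil_or_concat t |>.resolve_left ht
  have hx : x = 1 := by simpa using congrArg List.head? h
  simp [hx]

lemma Pnext_append_one (s : List ℤ) :
    Pnext ((1 :: s) ++ [1]) =
      (1 :: s) ++ [0] ++ (1 :: s).reverse.map (fun x => -x) := by
  have hl : ((1 :: s) ++ [1] : List ℤ).getLast! = 1 := by
    simp [List.getLast!_eq_getLast?_getD, List.getLast?_cons]
  rw [Pnext, if_neg (by rw [hl]; simp), List.dropLast_concat]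

lemma Pseq_shape (n : ℕ) : ∃ t, t ≠ [] ∧ Pseq n = 1 :: t ∧
    ((1 :: t).reverse = 1 :: t ∨ (1 :: t).reverse = (1 :: t).map (fun x => -x)) := by
  induction n with
  | zero => exact ⟨[-1], by simp, rfl, by simp⟩
  | succ n ih =>
    obtain ⟨t, ht, hP, h | h⟩ := ih
    · rw [Pseq, hP, eq_append_one_of_reverse_eq ht h, Pnext_append_one]
      exact ⟨t.dropLast ++ [0] ++ (1 :: t.dropLast).reverse.map (fun x => -x), by simp, by simp,
        Or.inr (by simp)⟩
    · rw [Pseq, hP, Pnext_of_reverse_eq_map_neg h]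
      refine ⟨t ++ (1 :: t).map (fun x => -x), by simp, by simp, Or.inl ?_⟩
      rw [← List.cons_append, ← h, List.reverse_append, List.reverse_reverse]

/-- In terms of generating polynomials, `P_{n+1} = (1 - X ^ d) P_n` for some `d > 0`. -/
lemma exists_weightedSum_Pseq_succ (n : ℕ) : ∃ d : ℕ, 0 < d ∧ ∀ f : ℕ → ℝ,
    weightedSum (Pseq (n + 1)) f =
      weightedSum (Pseq n) f - weightedSum (Pseq n) (fun i => f (i + d)) := by
  obtain ⟨t, ht, hP, h | h⟩ := Pseq_shape n
  · have hs := eq_append_one_of_reverse_eq ht h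
    obtain ⟨b, hb⟩ : ∃ b, b = 1 :: t.dropLast := ⟨_, rfl⟩
    rw [← hb] at hs
    refine ⟨b.length, by simp [hb], fun f => ?_⟩
    have hr : b ++ [1] = 1 :: b.reverse := by
      rw [← hs, ← h, hs, List.reverse_append]; simp
    rw [Pseq, hP, hs, hb, Pnext_append_one, ← hb]
    conv_rhs => rw [weightedSum_append, hr, weightedSum_cons]
    rw [weightedSum_append, weightedSum_append, weightedSum_map_neg]
    simp only [weightedSum_cons, weightedSum_nil, List.length_append, List.length_singleton]
    simp only [add_assoc, add_comm 1]
    push_cast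
    ring
  · refine ⟨(Pseq n).length, by simp [hP], fun f => ?_⟩
    rw [Pseq, hP, Pnext_of_reverse_eq_map_neg h, weightedSum_append, weightedSum_map_neg]
    ring

open Polynomial in
lemma coeff_taylor_of_natDegree_le_succ {p : ℝ[X]} {m : ℕ} (hp : p.natDegree ≤ m + 1) (r : ℝ) :
    (taylor r p).coeff m = p.coeff m + (m + 1) * r * p.coeff (m + 1) := by
  have hdeg : (hasseDeriv m p).natDegree < 2 :=
    (natDegree_hasseDeriv_le p m).trans_lt (by omega)
  rw [taylor_coeff, eval_eq_sum_range' hdeg]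
  simp [Finset.sum_range_succ, hasseDeriv_coeff, add_comm 1 m]
  ring

open Polynomial in
/-- `P_{n+1}` acts on polynomials of degree at most `n + 1` as a multiple, of sign `(-1)^(n+1)`,
of the coefficient of degree `n + 1`. -/
lemma exists_weightedSum_Pseq_eval (n : ℕ) : ∃ c : ℝ, 0 < c ∧
    ∀ p : ℝ[X], p.natDegree ≤ n + 1 →
      weightedSum (Pseq n) (fun i => p.eval (i : ℝ)) = (-1) ^ (n + 1) * c * p.coeff (n + 1) := by
  induction n with
  | zero =>
    refine ⟨1, one_pos, fun p hp => ?_⟩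
    have hd : p.natDegree < 2 := by omega
    simp [Pseq, weightedSum_cons, weightedSum_nil, eval_eq_sum_range' hd, Finset.sum_range_succ]
  | succ n ih =>
    obtain ⟨c, hc, h⟩ := ih
    obtain ⟨d, hd, hstep⟩ := exists_weightedSum_Pseq_succ n
    have hd' : (0 : ℝ) < d := by exact_mod_cast hd
    refine ⟨(n + 2) * d * c, by positivity, fun p hp => ?_⟩
    have hcoeff : (p - taylor (d : ℝ) p).coeff (n + 1) = -((n + 2) * d * p.coeff (n + 2)) := by
      rw [coeff_sub, coeff_taylor_of_natDegree_le_succ hp]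
      push_cast
      ring
    have htop : (p - taylor (d : ℝ) p).natDegree ≤ n + 1 := by
      rw [natDegree_le_iff_coeff_eq_zero]
      intro N hN
      rcases (show n + 2 ≤ N from hN).eq_or_lt with rfl | hN'
      · rw [coeff_sub, taylor_coeff, eval_eq_sum_range' (n := 1)
          ((natDegree_hasseDeriv_le p _).trans_lt (by omega))]
        simp [hasseDeriv_coeff]
      · refine coeff_eq_zero_of_natDegree_lt ((natDegree_sub_le _ _).trans_lt ?_)
        rw [natDegree_taylor, max_self]
        omega
    have key := h _ htop
    rw [hcoeff] at key
    rw [hstep]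
    have hsub : weightedSum (Pseq n) (fun i => (p - taylor (d : ℝ) p).eval (i : ℝ)) =
        weightedSum (Pseq n) (fun i => p.eval (i : ℝ)) -
          weightedSum (Pseq n) (fun i => p.eval ((i + d : ℕ) : ℝ)) := by
      simp [weightedSum, taylor_eval, mul_sub]
    rw [← hsub, key]
    ring

lemma genBinom_eq_choose (δ : ℝ) (m : ℕ) : genBinom δ m = Ring.choose δ m := by
  rw [Ring.choose_eq_smul, genBinom, ← Polynomial.aeval_eq_smeval, Polynomial.aeval_def,
    Polynomial.eval₂_eq_eval_map, descPochhammer_map, descPochhammer_eval_eq_prod_range,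
    smul_eq_mul, div_eq_inv_mul]

lemma genBinom_pos {δ : ℝ} {m : ℕ} (h : (m : ℝ) - 1 < δ) : 0 < genBinom δ m := by
  refine div_pos (Finset.prod_pos fun j hj => ?_) (by positivity)
  have : (j : ℝ) + 1 ≤ m := by exact_mod_cast Finset.mem_range.mp hj
  linarith

/-- Taylor expansion of `(1 + y) ^ δ` at `0`. -/
lemma one_add_rpow_sub_sum_isBigO (δ : ℝ) (m : ℕ) :
    (fun y : ℝ => (1 + y) ^ δ - ∑ j ∈ Finset.range m, genBinom δ j * y ^ j)
      =O[nhds 0] fun y => y ^ m := by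
  have h := (Real.one_add_rpow_hasFPowerSeriesAt_zero (a := δ)).isBigO_sub_partialSum_pow m
  refine (h.trans (isBigO_of_le _ fun y => by simp)).congr_left fun y => ?_
  simp only [FormalMultilinearSeries.partialSum, binomialSeries_apply, genBinom_eq_choose]
  simp

lemma sub_rpow_sub_sum_isLittleO (δ : ℝ) (m : ℕ) (x : ℝ) :
    (fun n : ℕ => ((n : ℝ) - x) ^ δ -
        ∑ j ∈ Finset.range (m + 1), genBinom δ j * (-x) ^ j * (n : ℝ) ^ (δ - j))
      =o[atTop] fun n : ℕ => (n : ℝ) ^ (δ - m) := by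
  have hinv : Tendsto (fun n : ℕ => (n : ℝ)⁻¹) atTop (nhds 0) :=
    tendsto_inv_atTop_nhds_zero_nat
  have hy : Tendsto (fun n : ℕ => -x * (n : ℝ)⁻¹) atTop (nhds 0) := by
    simpa using hinv.const_mul (-x)
  have hT : (fun n : ℕ => (1 + -x * (n : ℝ)⁻¹) ^ δ -
      ∑ j ∈ Finset.range (m + 1), genBinom δ j * (-x * (n : ℝ)⁻¹) ^ j)
        =o[atTop] fun n : ℕ => ((n : ℝ)⁻¹) ^ m := by
    refine ((one_add_rpow_sub_sum_isBigO δ (m + 1)).comp_tendsto hy).trans_isLittleO ?_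
    have h1 : (fun n : ℕ => (-x) ^ (m + 1) * (n : ℝ)⁻¹ * ((n : ℝ)⁻¹) ^ m)
        =o[atTop] fun n : ℕ => 1 * ((n : ℝ)⁻¹) ^ m := by
      refine IsLittleO.mul_isBigO ?_ (isBigO_refl _ _)
      rw [isLittleO_one_iff]
      simpa using hinv.const_mul ((-x) ^ (m + 1))
    refine h1.congr (fun n => ?_) (fun n => one_mul _)
    simp only [Function.comp]
    ring
  have hmul := (isBigO_refl (fun n : ℕ => (n : ℝ) ^ δ) atTop).mul_isLittleO hT
  refine hmul.congr' ?_ ?_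
  · filter_upwards [eventually_gt_atTop 0, tendsto_natCast_atTop_atTop.eventually_ge_atTop x]
      with n hn hx
    have hn' : (0 : ℝ) < n := by exact_mod_cast hn
    have hsplit : (n : ℝ) - x = n * (1 + -x * (n : ℝ)⁻¹) := by field_simp; ring
    have hnn : 0 ≤ 1 + -x * (n : ℝ)⁻¹ := by
      have : 0 ≤ (n : ℝ) * (1 + -x * (n : ℝ)⁻¹) := by rw [← hsplit]; linarith
      exact nonneg_of_mul_nonneg_right this hn'
    rw [hsplit, Real.mul_rpow hn'.le hnn, mul_sub, Finset.mul_sum]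
    congr 1
    refine Finset.sum_congr rfl fun j _ => ?_
    rw [Real.rpow_sub hn', Real.rpow_natCast, mul_pow, inv_pow]
    ring
  · filter_upwards [eventually_gt_atTop 0] with n hn
    have hn' : (0 : ℝ) < n := by exact_mod_cast hn
    rw [Real.rpow_sub hn', Real.rpow_natCast, inv_pow, div_eq_mul_inv]

/-- for `m ≥ 1`, `m - 1 < δ < m` and `P_m = ⟨a_0,…,a_k⟩`, the
sequence `E(n) = ∑_{i=0}^k a_i (n-i)^δ` (for `n > k`) satisfies
`E(n) = (-1)^m C(δ,m) (∑_{i=0}^k a_i i^m) n^{δ-m} + o(n^{δ-m})`; in particular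
`E` is ultimately positive and tends to `0`. -/
theorem Pseq_rpow_asymptotics (m : ℕ) (hm : 1 ≤ m) (δ : ℝ)
    (hδ₁ : (m : ℝ) - 1 < δ) (hδ₂ : δ < m) (E : ℕ → ℝ)
    (hE : ∀ n : ℕ, (Pseq (m - 1)).length - 1 < n →
      E n = ∑ i ∈ Finset.range (Pseq (m - 1)).length,
        ((Pseq (m - 1)).getD i 0 : ℝ) * ((n : ℝ) - (i : ℝ)) ^ δ) :
    (fun n : ℕ => E n -
        (-1 : ℝ) ^ m * genBinom δ m *
          (∑ i ∈ Finset.range (Pseq (m - 1)).length,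
            ((Pseq (m - 1)).getD i 0 : ℝ) * (i : ℝ) ^ m) * (n : ℝ) ^ (δ - m))
      =o[atTop] (fun n : ℕ => (n : ℝ) ^ (δ - m)) ∧
    (∀ᶠ n in atTop, 0 < E n) ∧ Tendsto E atTop (nhds 0) := by
  obtain ⟨k, rfl⟩ : ∃ k, m = k + 1 := ⟨m - 1, by omega⟩
  simp only [Nat.add_sub_cancel] at hE ⊢
  obtain ⟨c, hc, hmom⟩ := exists_weightedSum_Pseq_eval k
  have hmoment : ∀ j ≤ k + 1, ∑ i ∈ Finset.range (Pseq k).length,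
      ((Pseq k).getD i 0 : ℝ) * (i : ℝ) ^ j = if j = k + 1 then (-1) ^ (k + 1) * c else 0 := by
    intro j hj
    have h := hmom (Polynomial.X ^ j) (by simpa using hj)
    simpa [weightedSum, Polynomial.coeff_X_pow, eq_comm] using h
  have hexp := hmoment (k + 1) le_rfl
  rw [if_pos rfl] at hexp
  set K : ℝ := (-1 : ℝ) ^ (k + 1) * genBinom δ (k + 1) *
    (∑ i ∈ Finset.range (Pseq k).length, ((Pseq k).getD i 0 : ℝ) * (i : ℝ) ^ (k + 1)) with hK
  have hKpos : 0 < K := by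
    have hsign : ((-1 : ℝ) ^ (k + 1)) * (-1) ^ (k + 1) = 1 := by
      rw [← mul_pow]; simp
    have : K = genBinom δ (k + 1) * c := by
      rw [hK, hexp]
      linear_combination (genBinom δ (k + 1) * c) * hsign
    rw [this]
    exact mul_pos (genBinom_pos hδ₁) hc
  have hmain : (fun n : ℕ => E n - K * (n : ℝ) ^ (δ - (k + 1 : ℕ)))
      =o[atTop] fun n : ℕ => (n : ℝ) ^ (δ - (k + 1 : ℕ)) := by
    have hsum := IsLittleO.sum (s := Finset.range (Pseq k).length) fun i _ =>
      (sub_rpow_sub_sum_isLittleO δ (k + 1) (i : ℝ)).const_mul_left ((Pseq k).getD i 0 : ℝ)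
    refine hsum.congr' ?_ EventuallyEq.rfl
    filter_upwards [eventually_gt_atTop ((Pseq k).length - 1)] with n hn
    rw [hE n hn, Finset.sum_apply]
    simp only [mul_sub, Finset.sum_sub_distrib, Finset.mul_sum]
    congr 1
    rw [Finset.sum_comm]
    have hinner : ∀ j, ∑ i ∈ Finset.range (Pseq k).length, ((Pseq k).getD i 0 : ℝ) *
        (genBinom δ j * (-(i : ℝ)) ^ j * (n : ℝ) ^ (δ - j)) =
        (-1) ^ j * genBinom δ j * (∑ i ∈ Finset.range (Pseq k).length,
          ((Pseq k).getD i 0 : ℝ) * (i : ℝ) ^ j) * (n : ℝ) ^ (δ - j) := by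
      intro j
      rw [Finset.mul_sum, Finset.sum_mul]
      refine Finset.sum_congr rfl fun i _ => ?_
      rw [neg_pow]
      ring
    rw [Finset.sum_congr rfl fun j _ => hinner j, Finset.sum_range_succ, Finset.sum_eq_zero,
      zero_add]
    intro j hj
    have hj' := Finset.mem_range.mp hj
    rw [hmoment j hj'.le, if_neg hj'.ne]
    simp
  have hpow : Tendsto (fun n : ℕ => (n : ℝ) ^ (δ - (k + 1 : ℕ))) atTop (nhds 0) := by
    have h := (tendsto_rpow_neg_atTop (y := (k + 1 : ℕ) - δ) (by linarith)).comp
      (tendsto_natCast_atTop_atTop (R := ℝ))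
    simpa [Function.comp_def] using h
  refine ⟨hmain, ?_, ?_⟩
  · filter_upwards [hmain.bound (half_pos hKpos), eventually_gt_atTop 0] with n hn hn0
    have hp : (0 : ℝ) < (n : ℝ) ^ (δ - (k + 1 : ℕ)) := by positivity
    rw [Real.norm_eq_abs, Real.norm_of_nonneg hp.le] at hn
    nlinarith [(abs_le.mp hn).1, mul_pos hKpos hp]
  · have h := (hmain.trans_tendsto hpow).add (hpow.const_mul K)
    simpa using h
end
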